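/- (Eigenvalue counting in the low-energy window.) Let V_hi be a hierarchical potential on ℤ^d with barrier height h > 4d+1, width exponent α > 1 and well density N, and let H(ω) = 2d − Δ + V_hi + βω with 0 < β ≤ 1. There is a scale k^{(1)} depending only on d, β, h, α, d₀ such that for all k ≥ k^{(1)} and every configuration ω: #( Spec(H_{Λ̄_k}) ∩ [−ι, 4d+β+ι] ) ≤ 2 · N^{k−k^{(1)}} · (16 d_{k^{(1)}} + 1)^d, where eigenvalues are counted with multiplicity. -/

import Mathlib

noncomputable section

open scoped ENNReal

namespace HierABM

/-- Sites of the lattice `ℤ^d`. -/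
abbrev Site (d : ℕ) := Fin d → ℤ

variable {d : ℕ}

/-- The `ℓ∞`-norm of a lattice site (as a natural number). -/
def linf (x : Site d) : ℕ := Finset.univ.sup fun i => (x i).natAbs

/-- The `ℓ∞`-distance between two lattice sites (as a natural number). -/
def linfDist (x y : Site d) : ℕ := Finset.univ.sup fun i => (x i - y i).natAbs

/-- The `ℓ¹`-distance between two lattice sites; `x ∼ y` means `l1dist x y = 1`. -/
def l1dist (x y : Site d) : ℤ := ∑ i, |x i - y i|

/-- The `i`-th standard basis vector of `ℤ^d`. -/
def unit (i : Fin d) : Site d := fun j => if j = i then 1 else 0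

/-- The discrete Laplacian `Δf(x) = ∑_{y ∼ x} f(y)`. -/
def discLap (f : Site d → ℝ) (x : Site d) : ℝ :=
  ∑ i : Fin d, (f (x + unit i) + f (x - unit i))

/-- The pointwise action of `H(ω) = 2d - Δ + V_hi + β ω`. -/
def hamAct (Vhi : Site d → ℝ) (β : ℝ) (ω : Site d → Bool)
    (f : Site d → ℝ) (x : Site d) : ℝ :=
  (2 * d + Vhi x + β * (if ω x then 1 else 0)) * f x - discLap f x

/-- The Newtonian scales `d_k = d₀^(α^k)`, i.e. `d_{k+1} = d_k^α`. -/
def nscale (d₀ α : ℝ) (k : ℕ) : ℝ := d₀ ^ (α ^ k)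

/-- The block `Λ_k(j) = {x : |x - j|_∞ ≤ 2⌊3 d_k⌋}`. -/
def LambdaS (d₀ α : ℝ) (k : ℕ) (j : Site d) : Set (Site d) :=
  {x | (linfDist x j : ℤ) ≤ 2 * ⌊3 * nscale d₀ α k⌋}

/-- `diam A ≤ r` in the `ℓ∞`-metric. -/
def diamLE (A : Set (Site d)) (r : ℤ) : Prop :=
  ∀ a ∈ A, ∀ b ∈ A, (linfDist a b : ℤ) ≤ r

/-- `dist(A, B) ≥ r` in the `ℓ∞`-metric. -/
def setDistGE (A B : Set (Site d)) (r : ℝ) : Prop :=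
  ∀ a ∈ A, ∀ b ∈ B, r ≤ (linfDist a b : ℝ)

/-- The potential with zero set `W` is `(k, N)`-hierarchical in `Λ_k(j)`. -/
def IsHierIn (d₀ α : ℝ) (N : ℕ) (W : Set (Site d)) : ℕ → Site d → Prop
  | 0, _ => True
  | 1, j => ∃ (m : ℕ) (C : Fin (m + 1) → Set (Site d)),
      m + 1 ≤ N ∧
      W ∩ LambdaS d₀ α 1 j = ⋃ s, C s ∧
      (∀ s, diamLE (C s) (4 * ⌊3 * d₀⌋)) ∧
      C 0 ⊆ LambdaS d₀ α 0 j ∧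
      (∀ s t, s ≠ t → setDistGE (C s) (C t) (2 * nscale d₀ α 1))
  | (k + 2), j => ∃ (m : ℕ) (C : Fin (m + 1) → Set (Site d)),
      m + 1 ≤ N ∧
      W ∩ LambdaS d₀ α (k + 2) j = ⋃ s, C s ∧
      C 0 ⊆ LambdaS d₀ α (k + 1) j ∧
      (∀ s t, s ≠ t → setDistGE (C s) (C t) (2 * nscale d₀ α (k + 2))) ∧
      IsHierIn d₀ α N W (k + 1) j ∧
      (∀ s : Fin (m + 1), s ≠ 0 → ∃ js : Site d,
        LambdaS d₀ α (k + 1) js ⊆ LambdaS d₀ α (k + 2) j ∧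
        C s ⊆ LambdaS d₀ α (k + 1) js ∧
        IsHierIn d₀ α N W (k + 1) js)

/-- `V_hi` is a hierarchical potential with scales `d₀, α`, well density `N`
and barrier height `h`. -/
def IsHierPot (d₀ α : ℝ) (N : ℕ) (h : ℝ) (Vhi : Site d → ℝ) : Prop :=
  (∀ x, Vhi x = 0 ∨ Vhi x = h) ∧
  ∀ k : ℕ, 1 ≤ k → IsHierIn d₀ α N {x | Vhi x = 0} k 0

/-- The parameter `ι = min{1/100, (h - 4d - β)/2}`. -/
def iota (d : ℕ) (h β : ℝ) : ℝ := min (1 / 100) ((h - 4 * d - β) / 2)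

/-- `ℙ` is the i.i.d. Bernoulli(1/2) product measure on `{0,1}^{ℤ^d}`. -/
def IsBernoulliProduct (d : ℕ) (ℙ : MeasureTheory.Measure (Site d → Bool)) : Prop :=
  ∀ (S : Finset (Site d)) (v : Site d → Bool),
    ℙ {ω | ∀ x ∈ S, ω x = v x} = (1 / 2 : ℝ≥0∞) ^ S.card

/-- The lattice box of (integer) radius `R` about `c`, as a finset. -/
def boxF {d : ℕ} (c : Site d) (R : ℤ) : Finset (Site d) :=
  Fintype.piFinset fun i => Finset.Icc (c i - R) (c i + R)

/-- The block `Λ_k(j)` as a finset. -/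
def LambdaF {d : ℕ} (d₀ α : ℝ) (k : ℕ) (j : Site d) : Finset (Site d) :=
  boxF j (2 * ⌊3 * nscale d₀ α k⌋)

/-- `Λ̄_k(j)`, the `(d_{k+1}/10)`-neighborhood of `Λ_k(j)`, as a finset. -/
def barLambdaF {d : ℕ} (d₀ α : ℝ) (k : ℕ) (j : Site d) : Finset (Site d) :=
  boxF j (2 * ⌊3 * nscale d₀ α k⌋ + ⌊nscale d₀ α (k + 1) / 10⌋)

/-- The Dirichlet restriction `H_Λ = R_Λ H(ω) R_Λ` of `H(ω) = 2d - Δ + V_hi + βω`,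
as a matrix indexed by `Λ`: its entries are `2d + V_hi(x) + βω(x)` on the diagonal and
`-1` between nearest neighbors. -/
def HMat {d : ℕ} (Vhi : Site d → ℝ) (β : ℝ) (ω : Site d → Bool) (Λ : Finset (Site d)) :
    Matrix Λ Λ ℝ := fun x y =>
  (if x = y then 2 * d + Vhi (x : Site d) + β * (if ω (x : Site d) then 1 else 0) else 0)
  - (if l1dist (x : Site d) (y : Site d) = 1 then 1 else 0)

section Spectral

open Matrix

variable {n : Type*} [Fintype n]

/-- If the quadratic form of a real symmetric matrix is at least `h` on the vectors vanishing on
`S`, then at most `#S` eigenvalues are below `h`. -/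
theorem card_eigenvalues_le_card_of_form_ge [DecidableEq n] {A : Matrix n n ℝ}
    (hA : A.IsHermitian) (S : Finset n) {E h : ℝ} (hE : E < h)
    (hform : ∀ f : n → ℝ, (∀ x ∈ S, f x = 0) → h * (f ⬝ᵥ f) ≤ f ⬝ᵥ (A *ᵥ f)) :
    (Finset.univ.filter fun i => hA.eigenvalues i ≤ E).card ≤ S.card := by
  set T := Finset.univ.filter fun i => hA.eigenvalues i ≤ E
  let v : n → n → ℝ := fun i => ⇑(hA.eigenvectorBasis i)
  have horth : ∀ i j, v i ⬝ᵥ v j = if i = j then 1 else 0 := by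
    intro i j
    have := orthonormal_iff_ite.mp hA.eigenvectorBasis.orthonormal j i
    simp only [eq_comm (a := j)] at this
    rw [← this]
    simp [v, dotProduct, PiLp.inner_apply]
  let φ : (T → ℝ) →ₗ[ℝ] (n → ℝ) := Fintype.linearCombination ℝ fun i : T => v i
  have hφ : ∀ c, φ c = ∑ i : T, c i • v i := fun c => by simp [φ, Fintype.linearCombination_apply]
  have hAφ : ∀ c, A *ᵥ φ c = φ fun i => hA.eigenvalues i * c i := by
    intro c
    simp only [hφ, mulVec_sum, mulVec_smul]
    refine Finset.sum_congr rfl fun i _ => ?_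
    rw [hA.mulVec_eigenvectorBasis, smul_smul, mul_comm]
  have hdot : ∀ b c, φ b ⬝ᵥ φ c = ∑ i, b i * c i := by
    intro b c
    simp [hφ, sum_dotProduct, dotProduct_sum, horth, mul_comm]
  let ψ : (T → ℝ) →ₗ[ℝ] (S → ℝ) := (LinearMap.funLeft ℝ ℝ ((↑) : S → n)).comp φ
  have hψ : Function.Injective ψ := by
    rw [injective_iff_map_eq_zero]
    intro c hc
    have hzero : ∀ x ∈ S, φ c x = 0 := fun x hx => congrFun hc ⟨x, hx⟩
    have hge := hform _ hzero
    rw [hAφ, hdot, hdot] at hge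
    have hle : ∑ i : T, c i * (hA.eigenvalues i * c i) ≤ E * ∑ i, c i * c i := by
      rw [Finset.mul_sum]
      refine Finset.sum_le_sum fun i _ => ?_
      have hi : hA.eigenvalues i ≤ E := (Finset.mem_filter.mp i.2).2
      nlinarith [mul_self_nonneg (c i)]
    have hnn : 0 ≤ ∑ i, c i * c i := Finset.sum_nonneg fun i _ => mul_self_nonneg _
    have h0 : ∑ i, c i * c i = 0 := by nlinarith
    funext i
    have := (Finset.sum_eq_zero_iff_of_nonneg fun i _ => mul_self_nonneg (c i)).mp h0 i
      (Finset.mem_univ i)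
    simpa using this
  simpa using LinearMap.finrank_le_finrank_of_injective hψ

/-- The quadratic form of a symmetric nonnegative matrix with row sums at most `D` is at most
`D`. -/
theorem sum_mul_le_of_rowSum_le {a : n → n → ℝ} (hsymm : ∀ x y, a x y = a y x)
    (hnn : ∀ x y, 0 ≤ a x y) {D : ℝ} (hrow : ∀ x, ∑ y, a x y ≤ D) (f : n → ℝ) :
    ∑ x, ∑ y, a x y * (f x * f y) ≤ D * ∑ x, f x ^ 2 := by
  have hswap : ∑ x, ∑ y, a x y * f y ^ 2 = ∑ x, ∑ y, a x y * f x ^ 2 := by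
    rw [Finset.sum_comm]
    simp only [hsymm]
  have hle : ∑ x, ∑ y, a x y * f x ^ 2 ≤ D * ∑ x, f x ^ 2 := by
    rw [Finset.mul_sum]
    refine Finset.sum_le_sum fun x _ => ?_
    rw [← Finset.sum_mul]
    exact mul_le_mul_of_nonneg_right (hrow x) (sq_nonneg _)
  have hamgm : ∑ x, ∑ y, a x y * (f x * f y) ≤
      ∑ x, ∑ y, (a x y * f x ^ 2 / 2 + a x y * f y ^ 2 / 2) := by
    refine Finset.sum_le_sum fun x _ => Finset.sum_le_sum fun y _ => ?_
    nlinarith [mul_nonneg (hnn x y) (sq_nonneg (f x - f y))]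
  simp only [Finset.sum_add_distrib, ← Finset.sum_div] at hamgm
  linarith

end Spectral

theorem l1dist_comm (x y : Site d) : l1dist x y = l1dist y x := by
  simp only [l1dist, abs_sub_comm]

theorem exists_eq_add_unit_of_l1dist_eq_one {x y : Site d} (hxy : l1dist x y = 1) :
    ∃ i, y = x + unit i ∨ y = x - unit i := by
  obtain ⟨i, hi⟩ : ∃ i, x i ≠ y i := by
    by_contra! hall
    simp [l1dist, hall] at hxy
  have hsplit := Finset.add_sum_erase Finset.univ (fun i => |x i - y i|) (Finset.mem_univ i)
  have hrest : 0 ≤ ∑ j ∈ Finset.univ.erase i, |x j - y j| :=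
    Finset.sum_nonneg fun _ _ => abs_nonneg _
  have hpos : 0 < |x i - y i| := abs_pos.mpr (sub_ne_zero.mpr hi)
  simp only [l1dist] at hxy
  have hone : |x i - y i| = 1 := by omega
  have hzero : ∀ j, j ≠ i → x j = y j := by
    intro j hj
    have := (Finset.sum_eq_zero_iff_of_nonneg fun j _ => abs_nonneg (x j - y j)).mp
      (by omega : ∑ j ∈ Finset.univ.erase i, |x j - y j| = 0) j (by simp [hj])
    exact sub_eq_zero.mp (abs_eq_zero.mp this)
  refine ⟨i, ?_⟩
  rcases (abs_eq zero_le_one).mp hone with hs | hs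
  · right
    funext j
    by_cases hj : j = i
    · subst hj
      simp only [unit, Pi.sub_apply, if_true]
      omega
    · simp [unit, hj, hzero j hj]
  · left
    funext j
    by_cases hj : j = i
    · subst hj
      simp only [unit, Pi.add_apply, if_true]
      omega
    · simp [unit, hj, hzero j hj]

theorem card_neighbors_le (Λ : Finset (Site d)) (x : Site d) :
    (Finset.univ.filter fun y : Λ => l1dist x y = 1).card ≤ 2 * d := by
  classical
  let nbrs : Finset (Site d) :=
    Finset.univ.image (fun i => x + unit i) ∪ Finset.univ.image (fun i => x - unit i)
  have hnbrs : nbrs.card ≤ 2 * d := by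
    refine (Finset.card_union_le _ _).trans ?_
    have h₁ := Finset.card_image_le (s := Finset.univ) (f := fun i : Fin d => x + unit i)
    have h₂ := Finset.card_image_le (s := Finset.univ) (f := fun i : Fin d => x - unit i)
    simp only [Finset.card_univ, Fintype.card_fin] at h₁ h₂
    omega
  refine (Finset.card_le_card_of_injOn ((↑) : Λ → Site d) ?_
    Subtype.val_injective.injOn).trans hnbrs
  intro y hy
  obtain ⟨i, hi | hi⟩ := exists_eq_add_unit_of_l1dist_eq_one
    (Finset.mem_filter.mp (Finset.mem_coe.mp hy)).2
  · exact Finset.mem_union_left _ (by simp [hi])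
  · exact Finset.mem_union_right _ (by simp [hi])

open Matrix in
/-- The quadratic form of `H_Λ` is at least `h` on functions supported off the wells. -/
theorem le_dotProduct_HMat_mulVec {Vhi : Site d → ℝ} {h β : ℝ} (hβ : 0 ≤ β)
    (ω : Site d → Bool) (Λ : Finset (Site d)) (f : Λ → ℝ)
    (hf : ∀ x : Λ, f x = 0 ∨ h ≤ Vhi x) :
    h * (f ⬝ᵥ f) ≤ f ⬝ᵥ (HMat Vhi β ω Λ *ᵥ f) := by
  let a : Λ → Λ → ℝ := fun x y => if l1dist (x : Site d) y = 1 then 1 else 0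
  have hadj : ∑ x, ∑ y, a x y * (f x * f y) ≤ 2 * d * ∑ x, f x ^ 2 := by
    refine sum_mul_le_of_rowSum_le (fun x y => ?_) (fun x y => ?_) (fun x => ?_) f
    · simp only [a, l1dist_comm]
    · simp only [a]
      positivity
    · simp only [a, Finset.sum_boole]
      exact_mod_cast card_neighbors_le Λ x
  have hexp : f ⬝ᵥ (HMat Vhi β ω Λ *ᵥ f) =
      ∑ x : Λ, (2 * d + Vhi x + β * (if ω x then 1 else 0)) * f x ^ 2 -
        ∑ x, ∑ y, a x y * (f x * f y) := by
    simp only [dotProduct, mulVec, HMat, sub_mul, Finset.sum_sub_distrib, mul_sub, ite_mul,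
      zero_mul, Finset.sum_ite_eq, Finset.mem_univ, if_true, Finset.mul_sum, a]
    congr 1
    · exact Finset.sum_congr rfl fun x _ => by ring
    · exact Finset.sum_congr rfl fun x _ => Finset.sum_congr rfl fun y _ => by
        split_ifs <;> ring
  have hdiag : 2 * d * ∑ x, f x ^ 2 + h * (f ⬝ᵥ f) ≤
      ∑ x : Λ, (2 * d + Vhi x + β * (if ω x then 1 else 0)) * f x ^ 2 := by
    simp only [dotProduct, Finset.mul_sum, ← Finset.sum_add_distrib]
    refine Finset.sum_le_sum fun x _ => ?_
    rcases hf x with hx | hx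
    · simp [hx]
    · have hω : 0 ≤ β * (if ω x then (1 : ℝ) else 0) := by positivity
      nlinarith [sq_nonneg (f x)]
  linarith

/-- The eigenvalues of `H_Λ` below the barrier height are at most as many as the well sites. -/
theorem card_eigenvalues_HMat_le {Vhi : Site d → ℝ} {h β E : ℝ}
    (hV : ∀ x, Vhi x = 0 ∨ Vhi x = h) (hβ : 0 ≤ β) (hE : E < h) (ω : Site d → Bool)
    (Λ : Finset (Site d)) (hH : (HMat Vhi β ω Λ).IsHermitian) :
    (Finset.univ.filter fun i => hH.eigenvalues i ≤ E).card ≤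
      ({x | Vhi x = 0} ∩ (Λ : Set (Site d))).ncard := by
  classical
  let S : Finset Λ := Finset.univ.filter fun x => Vhi x = 0
  have hS : S.card = ({x | Vhi x = 0} ∩ (Λ : Set (Site d))).ncard := by
    rw [← Set.ncard_coe_finset S, ← Set.ncard_image_of_injective _ Subtype.val_injective]
    congr 1
    ext x
    simp [S, and_comm]
  rw [← hS]
  refine card_eigenvalues_le_card_of_form_ge hH S hE fun f hf =>
    le_dotProduct_HMat_mulVec hβ ω Λ f fun x => ?_
  rcases hV x with hx | hx
  · exact .inl (hf x (by simp [S, hx]))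
  · exact .inr hx.ge

theorem linfDist_le_iff {x y : Site d} {R : ℕ} :
    linfDist x y ≤ R ↔ ∀ i, (x i - y i).natAbs ≤ R := by
  simp [linfDist]

theorem mem_boxF_iff {c x : Site d} {R : ℤ} (hR : 0 ≤ R) :
    x ∈ boxF c R ↔ (linfDist x c : ℤ) ≤ R := by
  lift R to ℕ using hR
  rw [Nat.cast_le, linfDist_le_iff]
  simp only [boxF, Fintype.mem_piFinset, Finset.mem_Icc]
  exact forall_congr' fun i => by omega

theorem linfDist_triangle_right (x y z : Site d) :
    linfDist x y ≤ linfDist x z + linfDist y z := by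
  rw [linfDist_le_iff]
  intro i
  have hx := linfDist_le_iff.mp (le_refl (linfDist x z)) i
  have hy := linfDist_le_iff.mp (le_refl (linfDist y z)) i
  omega

theorem card_boxF (c : Site d) (R : ℤ) : (boxF c R).card = (2 * R + 1).toNat ^ d := by
  simp only [boxF, Fintype.card_piFinset, Int.card_Icc]
  rw [Finset.prod_congr rfl fun i _ =>
    show (c i + R + 1 - (c i - R)).toNat = (2 * R + 1).toNat by congr 1; ring]
  simp

section Scales

variable {d₀ α : ℝ}

theorem one_lt_nscale (hd₀ : 1 < d₀) (hα : 1 < α) (k : ℕ) : 1 < nscale d₀ α k :=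
  Real.one_lt_rpow hd₀ (by positivity)

theorem exists_ten_mul_nscale_le (hd₀ : 1 < d₀) (hα : 1 < α) :
    ∃ k₁, ∀ k, k₁ ≤ k → 10 * nscale d₀ α k ≤ nscale d₀ α (k + 1) := by
  have hpow : Filter.Tendsto (fun k : ℕ => d₀ ^ (α ^ k * (α - 1))) Filter.atTop Filter.atTop :=
    (tendsto_rpow_atTop_of_base_gt_one _ hd₀).comp
      ((tendsto_pow_atTop_atTop_of_one_lt hα).atTop_mul_const (sub_pos.mpr hα))
  obtain ⟨k₁, hk₁⟩ := Filter.eventually_atTop.mp (hpow.eventually_ge_atTop 10)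
  refine ⟨k₁, fun k hk => ?_⟩
  have hsucc : nscale d₀ α (k + 1) = d₀ ^ (α ^ k * (α - 1)) * nscale d₀ α k := by
    rw [nscale, nscale, ← Real.rpow_add (by linarith)]
    congr 1
    ring
  rw [hsucc]
  exact mul_le_mul_of_nonneg_right (hk₁ k hk) (by linarith [one_lt_nscale hd₀ hα k])

theorem LambdaS_eq_coe_boxF (hd₀ : 1 < d₀) (hα : 1 < α) (k : ℕ) (j : Site d) :
    LambdaS d₀ α k j = boxF j (2 * ⌊3 * nscale d₀ α k⌋) := by
  have hnn : 0 ≤ ⌊3 * nscale d₀ α k⌋ :=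
    Int.floor_nonneg.mpr (by linarith [one_lt_nscale hd₀ hα k])
  ext x
  rw [Finset.mem_coe, mem_boxF_iff (by omega)]
  rfl

theorem finite_LambdaS (hd₀ : 1 < d₀) (hα : 1 < α) (k : ℕ) (j : Site d) :
    (LambdaS d₀ α k j).Finite := by
  rw [LambdaS_eq_coe_boxF hd₀ hα]
  exact Finset.finite_toSet _

theorem ncard_LambdaS_le (hd₀ : 1 < d₀) (hα : 1 < α) (k : ℕ) (j : Site d) :
    ((LambdaS d₀ α k j).ncard : ℝ) ≤ (12 * nscale d₀ α k + 1) ^ d := by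
  have hnn : 0 ≤ ⌊3 * nscale d₀ α k⌋ :=
    Int.floor_nonneg.mpr (by linarith [one_lt_nscale hd₀ hα k])
  rw [LambdaS_eq_coe_boxF hd₀ hα, Set.ncard_coe_finset, card_boxF, Nat.cast_pow]
  refine pow_le_pow_left₀ (Nat.cast_nonneg _) ?_ d
  rw [← Int.cast_natCast, Int.toNat_of_nonneg (by omega)]
  push_cast
  linarith [Int.floor_le (3 * nscale d₀ α k)]

/-- In the hierarchical structure, each well component of a block of level `k + 2` lies in a
hierarchical block of level `k + 1`. -/
theorem IsHierIn.exists_components {N : ℕ} {W : Set (Site d)} {k : ℕ} {j : Site d}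
    (hW : IsHierIn d₀ α N W (k + 2) j) :
    ∃ (m : ℕ) (C : Fin m → Set (Site d)), m ≤ N ∧ W ∩ LambdaS d₀ α (k + 2) j = ⋃ s, C s ∧
      (∀ s t, s ≠ t → setDistGE (C s) (C t) (2 * nscale d₀ α (k + 2))) ∧
      ∀ s, ∃ js, C s ⊆ W ∩ LambdaS d₀ α (k + 1) js ∧ IsHierIn d₀ α N W (k + 1) js := by
  obtain ⟨m, C, hm, hunion, hC₀, hdist, hj, hrest⟩ := hW
  have hCW : ∀ s, C s ⊆ W := fun s =>
    (Set.subset_iUnion C s).trans (hunion ▸ Set.inter_subset_left)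
  refine ⟨m + 1, C, hm, hunion, hdist, fun s => ?_⟩
  by_cases hs : s = 0
  · subst hs
    exact ⟨j, Set.subset_inter (hCW 0) hC₀, hj⟩
  · obtain ⟨js, -, hsub, hjs⟩ := hrest s hs
    exact ⟨js, Set.subset_inter (hCW s) hsub, hjs⟩

/-- A hierarchical block of level `k₁ + n` contains at most `N ^ n (12 d_{k₁} + 1)^d` well
sites. -/
theorem IsHierIn.ncard_wells_le (hd₀ : 1 < d₀) (hα : 1 < α) {N : ℕ} {W : Set (Site d)}
    {k₁ : ℕ} (hk₁ : 1 ≤ k₁) (n : ℕ) {j : Site d} (hW : IsHierIn d₀ α N W (k₁ + n) j) :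
    ((W ∩ LambdaS d₀ α (k₁ + n) j).ncard : ℝ) ≤ N ^ n * (12 * nscale d₀ α k₁ + 1) ^ d := by
  induction n generalizing j with
  | zero =>
    rw [pow_zero, one_mul]
    refine le_trans ?_ (ncard_LambdaS_le hd₀ hα k₁ j)
    exact_mod_cast Set.ncard_le_ncard Set.inter_subset_right (finite_LambdaS hd₀ hα _ _)
  | succ n ih =>
    obtain ⟨l, rfl⟩ : ∃ l, k₁ = l + 1 := ⟨k₁ - 1, by omega⟩
    have hlevel : l + 1 + (n + 1) = (l + n) + 2 := by omega
    have hlevel' : l + 1 + n = (l + n) + 1 := by omega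
    rw [hlevel] at hW ⊢
    rw [hlevel'] at ih
    obtain ⟨m, C, hm, hunion, -, hC⟩ := hW.exists_components
    have hscale : 0 ≤ (N : ℝ) ^ n * (12 * nscale d₀ α (l + 1) + 1) ^ d := by
      have := one_lt_nscale hd₀ hα (l + 1)
      positivity
    have hcomp : ∀ s, ((C s).ncard : ℝ) ≤ N ^ n * (12 * nscale d₀ α (l + 1) + 1) ^ d := by
      intro s
      obtain ⟨js, hsub, hjs⟩ := hC s
      refine le_trans ?_ (ih hjs)
      exact_mod_cast Set.ncard_le_ncard hsub
        ((finite_LambdaS hd₀ hα _ _).subset Set.inter_subset_right)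
    calc ((W ∩ LambdaS d₀ α (l + n + 2) j).ncard : ℝ)
        ≤ ∑ s, ((C s).ncard : ℝ) := by
          rw [hunion]
          exact_mod_cast Set.ncard_iUnion_le_of_fintype C
      _ ≤ ∑ _s : Fin m, (N : ℝ) ^ n * (12 * nscale d₀ α (l + 1) + 1) ^ d :=
          Finset.sum_le_sum fun s _ => hcomp s
      _ = m * ((N : ℝ) ^ n * (12 * nscale d₀ α (l + 1) + 1) ^ d) := by simp
      _ ≤ N * ((N : ℝ) ^ n * (12 * nscale d₀ α (l + 1) + 1) ^ d) :=
          mul_le_mul_of_nonneg_right (by exact_mod_cast hm) hscale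
      _ = N ^ (n + 1) * (12 * nscale d₀ α (l + 1) + 1) ^ d := by ring

/-- All wells in `Λ̄_k` belong to a single hierarchical block of level `k`. -/
theorem exists_wells_barLambdaF_subset (hd₀ : 1 < d₀) (hα : 1 < α) {N : ℕ} {W : Set (Site d)}
    {k : ℕ} (hk : 1 ≤ k) (hscale : 10 * nscale d₀ α k ≤ nscale d₀ α (k + 1)) {j : Site d}
    (hW : IsHierIn d₀ α N W (k + 1) j)
    (hne : (W ∩ (barLambdaF d₀ α k j : Set (Site d))).Nonempty) :
    ∃ js, W ∩ (barLambdaF d₀ α k j : Set (Site d)) ⊆ W ∩ LambdaS d₀ α k js ∧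
      IsHierIn d₀ α N W k js := by
  obtain ⟨l, rfl⟩ : ∃ l, k = l + 1 := ⟨k - 1, by omega⟩
  have hpos := one_lt_nscale hd₀ hα (l + 1)
  have hfl := Int.floor_le (3 * nscale d₀ α (l + 1))
  have hfl' := Int.floor_le (nscale d₀ α (l + 1 + 1) / 10)
  have hfl₁ : 0 ≤ ⌊3 * nscale d₀ α (l + 1)⌋ := Int.floor_nonneg.mpr (by linarith)
  have hfl₂ : 0 ≤ ⌊nscale d₀ α (l + 1 + 1) / 10⌋ := Int.floor_nonneg.mpr (by linarith)
  have hlt := Int.lt_floor_add_one (3 * nscale d₀ α (l + 1 + 1))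
  have hmem : ∀ x ∈ (barLambdaF d₀ α (l + 1) j : Set (Site d)),
      (linfDist x j : ℝ) ≤ 7 / 10 * nscale d₀ α (l + 1 + 1) := by
    intro x hx
    have hx' := (mem_boxF_iff (by omega)).mp (Finset.mem_coe.mp hx)
    have hx'' : (linfDist x j : ℝ) ≤
        2 * ⌊3 * nscale d₀ α (l + 1)⌋ + ⌊nscale d₀ α (l + 1 + 1) / 10⌋ := by
      exact_mod_cast hx'
    linarith
  have hsub : (barLambdaF d₀ α (l + 1) j : Set (Site d)) ⊆ LambdaS d₀ α (l + 2) j := by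
    intro x hx
    have hreal : (linfDist x j : ℝ) ≤ 2 * ⌊3 * nscale d₀ α (l + 1 + 1)⌋ := by
      linarith [hmem x hx]
    exact_mod_cast hreal
  obtain ⟨m, C, -, hunion, hdist, hC⟩ := hW.exists_components
  have hcover : ∀ x ∈ W ∩ (barLambdaF d₀ α (l + 1) j : Set (Site d)), ∃ s, x ∈ C s := by
    intro x hx
    exact Set.mem_iUnion.mp (hunion ▸ ⟨hx.1, hsub hx.2⟩)
  obtain ⟨x, hx⟩ := hne
  obtain ⟨s, hs⟩ := hcover x hx
  obtain ⟨js, hCs, hjs⟩ := hC s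
  refine ⟨js, fun y hy => ?_, hjs⟩
  obtain ⟨t, ht⟩ := hcover y hy
  rcases eq_or_ne s t with rfl | hst
  · exact hCs ht
  · have hfar := hdist s t hst x hs y ht
    have hnear : (linfDist x y : ℝ) ≤ linfDist x j + linfDist y j := by
      exact_mod_cast linfDist_triangle_right x y j
    have hfar' : 2 * nscale d₀ α (l + 1 + 1) ≤ (linfDist x y : ℝ) := hfar
    linarith [hmem x hx.2, hmem y hy.2]

end Scales

/-- **Eigenvalue counting in the low-energy window** (Lemma 3.3).

There is a scale `k⁽¹⁾`, depending only on `d, β, h, α, d₀`, such that for all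
`k ≥ k⁽¹⁾`, every hierarchical potential with these parameters and well density `N`,
and every configuration `ω`, the number of eigenvalues (with multiplicity) of
`H_{Λ̄_k}` in `[-ι, 4d+β+ι]` is at most `2 N^{k-k⁽¹⁾} (16 d_{k⁽¹⁾} + 1)^d`. -/
theorem eigenvalue_count_low_energy
    (d : ℕ) (hd : 1 ≤ d)
    (d₀ α : ℝ) (hd₀ : 1 < d₀) (hα : 1 < α)
    (h β : ℝ) (hh : 4 * (d : ℝ) + 1 < h) (hβ0 : 0 < β) (hβ1 : β ≤ 1) :
    ∃ k1 : ℕ,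
      ∀ N : ℕ, 1 ≤ N →
      ∀ Vhi : Site d → ℝ, IsHierPot d₀ α N h Vhi →
      ∀ ω : Site d → Bool,
      ∀ k : ℕ, k1 ≤ k →
      ∀ hH : (HMat Vhi β ω (barLambdaF d₀ α k (0 : Site d))).IsHermitian,
        ((Finset.univ.filter fun i => -(iota d h β) ≤ hH.eigenvalues i ∧
            hH.eigenvalues i ≤ 4 * (d : ℝ) + β + iota d h β).card : ℝ) ≤
          2 * (N : ℝ) ^ (k - k1) * (16 * nscale d₀ α k1 + 1) ^ (d : ℕ) := by
  obtain ⟨k₀, hk₀⟩ := exists_ten_mul_nscale_le hd₀ hα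
  refine ⟨k₀ + 1, fun N hN Vhi hVhi ω k hk hH => ?_⟩
  have hscale := one_lt_nscale hd₀ hα (k₀ + 1)
  have hE : 4 * (d : ℝ) + β + iota d h β < h := by
    have : iota d h β ≤ (h - 4 * d - β) / 2 := min_le_right _ _
    linarith
  have hwells : (({x | Vhi x = 0} ∩ (barLambdaF d₀ α k (0 : Site d) : Set (Site d))).ncard : ℝ) ≤
      (N : ℝ) ^ (k - (k₀ + 1)) * (12 * nscale d₀ α (k₀ + 1) + 1) ^ d := by
    rcases Set.eq_empty_or_nonempty ({x | Vhi x = 0} ∩ (barLambdaF d₀ α k (0 : Site d) : Set (Site d)))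
      with hempty | hne
    · rw [hempty, Set.ncard_empty, Nat.cast_zero]
      positivity
    · obtain ⟨js, hsub, hjs⟩ := exists_wells_barLambdaF_subset hd₀ hα (by omega)
        (hk₀ k (by omega)) (hVhi.2 (k + 1) (by omega)) hne
      obtain ⟨n, rfl⟩ := Nat.exists_eq_add_of_le hk
      rw [Nat.add_sub_cancel_left]
      refine le_trans ?_ (hjs.ncard_wells_le hd₀ hα (by omega) n)
      exact_mod_cast Set.ncard_le_ncard hsub
        ((finite_LambdaS hd₀ hα _ _).subset Set.inter_subset_right)
  have hcard : (Finset.univ.filter fun i => -(iota d h β) ≤ hH.eigenvalues i ∧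
      hH.eigenvalues i ≤ 4 * (d : ℝ) + β + iota d h β).card ≤
      ({x | Vhi x = 0} ∩ (barLambdaF d₀ α k (0 : Site d) : Set (Site d))).ncard :=
    (Finset.card_le_card (Finset.monotone_filter_right _ fun _ _ hi => hi.2)).trans
      (card_eigenvalues_HMat_le hVhi.1 hβ0.le hE ω _ hH)
  have hpow : (12 * nscale d₀ α (k₀ + 1) + 1) ^ d ≤ (16 * nscale d₀ α (k₀ + 1) + 1) ^ d :=
    pow_le_pow_left₀ (by positivity) (by linarith) d
  calc _ ≤ (({x | Vhi x = 0} ∩ (barLambdaF d₀ α k (0 : Site d) : Set (Site d))).ncard : ℝ) := by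
        exact_mod_cast hcard
    _ ≤ (N : ℝ) ^ (k - (k₀ + 1)) * (12 * nscale d₀ α (k₀ + 1) + 1) ^ d := hwells
    _ ≤ (N : ℝ) ^ (k - (k₀ + 1)) * (16 * nscale d₀ α (k₀ + 1) + 1) ^ d := by gcongr
    _ ≤ 2 * (N : ℝ) ^ (k - (k₀ + 1)) * (16 * nscale d₀ α (k₀ + 1) + 1) ^ d := by
        rw [mul_assoc]
        exact le_mul_of_one_le_left (by positivity) one_le_two

end HierABM
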